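/- arXiv:1909.09918 — 2 statements merged into one kernel-verified Lean document; each statement's English description precedes it below -/
import Mathlib

section
/- For every integer d ≥ 1, every integer M ≥ 0, and every real k with k > 1 - d/2, the real-exponent normalised moments m_{2s}^{N_0,d} = (1/N_0) ∫_{ℝ^d} ‖x‖^{2s} ρ^{M,d}(x) dx (which converge for real s > -d/2) satisfy the second order recurrence (2(k+d+1)/(2k+d)) m_{2k+2}^{N_0,d} = (2M + d + 1) m_{2k}^{N_0,d} + k (k + d/2 - 1) m_{2k-2}^{N_0,d}. -/
open MeasureTheory Real

/-- Physicists' Hermite polynomials: `H 0 = 1`, `H 1 x = 2x`,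
`H (n+2) x = 2x H (n+1) x - 2(n+1) H n x`. -/
noncomputable def hermiteH : ℕ → ℝ → ℝ
  | 0 => fun _ => 1
  | 1 => fun x => 2 * x
  | (n + 2) => fun x => 2 * x * hermiteH (n + 1) x - 2 * (n + 1) * hermiteH n x

/-- Normalised harmonic oscillator eigenfunctions. -/
noncomputable def ψho (l : ℕ) (x : ℝ) : ℝ :=
  (Real.sqrt (2 ^ l * (Nat.factorial l) * Real.sqrt π))⁻¹ * hermiteH l x * Real.exp (-x ^ 2 / 2)

/-- Ground-state density of the `d`-dimensional harmonically trapped Fermi gas,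
shell label `M`: sum over occupation arrays `l ∈ ℕ^d` with `l 1 + ⋯ + l d ≤ M`. -/
noncomputable def fermiDensity (d M : ℕ) (x : EuclideanSpace ℝ (Fin d)) : ℝ :=
  ∑ l ∈ Finset.filter (fun l => ∑ j, l j ≤ M)
      (Fintype.piFinset fun _ : Fin d => Finset.range (M + 1)),
    ∏ j, (ψho (l j) (x j)) ^ 2

/-- Generalised Laguerre polynomial `L_n^{(α)}` with natural parameter `α`. -/
noncomputable def laguerreL (n α : ℕ) (x : ℝ) : ℝ :=
  ∑ k ∈ Finset.range (n + 1),
    (-1 : ℝ) ^ k * (Nat.choose (n + α) (n - k) : ℝ) * x ^ k / (Nat.factorial k : ℝ)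


open PowerSeries in
noncomputable def gser (x : ℝ) : PowerSeries ℝ := PowerSeries.mk fun l => ψho l x ^ 2

lemma psi_sq (l : ℕ) (x : ℝ) : ψho l x ^ 2 =
    hermiteH l x ^ 2 / (2 ^ l * (Nat.factorial l)) * ((Real.sqrt π)⁻¹ * Real.exp (-x ^ 2)) := by
  unfold ψho
  have hp : 0 < Real.sqrt π := Real.sqrt_pos.mpr Real.pi_pos
  have h : (Real.exp (-x ^ 2 / 2)) ^ 2 = Real.exp (-x ^ 2) := by
    rw [← Real.exp_nat_mul]; congr 1; push_cast; ring
  rw [mul_pow, mul_pow, h, inv_pow, Real.sq_sqrt (by positivity)]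
  field_simp

open PowerSeries in
lemma gser_ode (x : ℝ) :
    (1 - X) * (1 + X) ^ 2 * d⁄dX ℝ (gser x) =
      (X * (1 + X) + C (2 * x ^ 2) * (1 - X)) * gser x := by
  have e1 : (1 - X) * (1 + X) ^ 2 * d⁄dX ℝ (gser x) =
      d⁄dX ℝ (gser x) + X * d⁄dX ℝ (gser x) - X * (X * d⁄dX ℝ (gser x))
       - X * (X * (X * d⁄dX ℝ (gser x))) := by ring
  have e2 : (X * (1 + X) + C (2 * x ^ 2) * (1 - X)) * gser x =
      X * gser x + X * (X * gser x) + C (2 * x ^ 2) * gser x - C (2 * x ^ 2) * (X * gser x) := by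
    ring
  rw [e1, e2]
  ext n
  rcases n with _ | _ | _ | n
  all_goals
    simp only [map_add, map_sub, coeff_C_mul, coeff_succ_X_mul, coeff_zero_X_mul, coeff_derivative,
      gser, coeff_mk, zero_add]
    simp only [psi_sq]
    simp only [hermiteH, Nat.factorial, pow_succ, zero_add]
    push_cast
    field_simp
    ring

open PowerSeries in
lemma prod_ode (d : ℕ) (s : Finset (Fin d)) (x : Fin d → ℝ) :
    (1 - X) * (1 + X) ^ 2 * d⁄dX ℝ (∏ j ∈ s, gser (x j)) =
      ((s.card : PowerSeries ℝ) * (X * (1 + X)) + C (2 * ∑ j ∈ s, x j ^ 2) * (1 - X))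
        * ∏ j ∈ s, gser (x j) := by
  classical
  induction s using Finset.induction_on with
  | empty => simp
  | insert a s ha ih =>
    rw [Finset.prod_insert ha, Finset.sum_insert ha, Finset.card_insert_of_notMem ha,
      Derivation.leibniz, smul_eq_mul, smul_eq_mul, mul_add (2:ℝ), map_add]
    push_cast
    linear_combination gser (x a) * ih + (∏ j ∈ s, gser (x j)) * gser_ode (x a)

open PowerSeries in
noncomputable def Fser (d : ℕ) (x : EuclideanSpace ℝ (Fin d)) : PowerSeries ℝ :=
  (∏ j, gser (x j)) * PowerSeries.mk 1

open PowerSeries in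
lemma Fser_ode (d : ℕ) (x : EuclideanSpace ℝ (Fin d)) :
    (1 - X) * (1 + X) ^ 2 * d⁄dX ℝ (Fser d x) =
      ((d : PowerSeries ℝ) * (X * (1 + X)) + (1 + X) ^ 2) * Fser d x
       + C 2 * (1 - X) * (C (‖x‖ ^ 2) * Fser d x) := by
  have h1 := prod_ode d Finset.univ x
  have h2 : (PowerSeries.mk 1 : PowerSeries ℝ) * (1 - X) = 1 := PowerSeries.mk_one_mul_one_sub_eq_one ℝ
  have h3 : (1 - X) * d⁄dX ℝ (PowerSeries.mk 1 : PowerSeries ℝ) = PowerSeries.mk 1 := by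
    have := congrArg (d⁄dX ℝ) h2
    rw [Derivation.leibniz] at this
    simp at this
    linear_combination this
  rw [Finset.card_univ, Fintype.card_fin] at h1
  rw [EuclideanSpace.real_norm_sq_eq, Fser, Derivation.leibniz, smul_eq_mul, smul_eq_mul]
  rw [map_mul] at h1
  linear_combination (PowerSeries.mk 1 : PowerSeries ℝ) * h1 + (1 + X)^2 * (∏ j, gser (x j)) * h3

open PowerSeries in
lemma coeff_Fser (d M : ℕ) (x : EuclideanSpace ℝ (Fin d)) :
    coeff M (Fser d x) = fermiDensity d M x := by
  classical
  rw [Fser, coeff_mul, Finset.Nat.sum_antidiagonal_eq_sum_range_succ_mk, fermiDensity]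
  simp only [coeff_mk, Pi.one_apply, mul_one]
  rw [← Finset.sum_fiberwise_of_maps_to (s := Finset.filter _ _) (t := Finset.range (M+1))
    (g := fun l : Fin d → ℕ => ∑ j, l j)]
  · refine Finset.sum_congr rfl fun n hn => ?_
    rw [coeff_prod]
    refine Finset.sum_bij (fun l _ => (l : Fin d → ℕ)) ?_ ?_ ?_ ?_
    · intro l hl
      simp only [Finset.mem_finsuppAntidiag, Finset.mem_range, Finset.mem_filter,
        Fintype.mem_piFinset] at hl hn ⊢
      have hl1 : ∑ j, l j = n := hl.1
      refine ⟨⟨fun j => ?_, by omega⟩, hl1⟩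
      have := Finset.single_le_sum (f := fun j => l j) (fun _ _ => Nat.zero_le _)
        (Finset.mem_univ j)
      have h2 : l j ≤ ∑ j, l j := this
      omega
    · intro a _ b _ h
      exact DFunLike.coe_injective h
    · intro l hl
      simp only [Finset.mem_filter] at hl
      refine ⟨Finsupp.equivFunOnFinite.symm l, ?_, by ext; simp⟩
      simp [hl.2]
    · intro l hl
      simp [gser]
  · intro l hl
    simp only [Finset.mem_filter, Finset.mem_range] at hl ⊢
    omega

open PowerSeries in
lemma vanish (b : ℝ) (D : ℝ → PowerSeries ℝ) (P : PowerSeries ℝ)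
    (h0 : ∀ s, b < s → constantCoeff (D s) = 0)
    (h : ∀ s, b < s → (1 - X) * (1 + X) ^ 2 * d⁄dX ℝ (D s) = P * D s + C 2 * (1 - X) * D (s + 1))
    (s : ℝ) (hs : b < s) : D s = 0 := by
  have key : ∀ n : ℕ, ∀ s, b < s → X ^ n ∣ D s := by
    intro n
    induction n with
    | zero => intro s _; simp
    | succ n ih =>
      intro s hs
      have hd : X ^ n ∣ (1 - X) * (1 + X) ^ 2 * d⁄dX ℝ (D s) := by
        rw [h s hs]
        exact dvd_add ((ih s hs).mul_left _) ((ih (s+1) (by linarith)).mul_left _)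
      have hu : IsUnit ((1 - X) * (1 + X) ^ 2 : PowerSeries ℝ) := by
        rw [PowerSeries.isUnit_iff_constantCoeff]; simp
      rw [hu.dvd_mul_left, X_pow_dvd_iff] at hd
      rw [X_pow_dvd_iff]
      intro m hm
      rcases m with _ | m
      · simpa using h0 s hs
      · have := hd m (by omega)
        rw [coeff_derivative] at this
        exact (mul_eq_zero.mp this).resolve_right (by positivity)
  ext n
  have := key (n+1) s hs
  rw [X_pow_dvd_iff] at this
  simpa using this n (by omega)

lemma hermiteH_cont : ∀ l : ℕ, Continuous (hermiteH l)
  | 0 => by unfold hermiteH; fun_prop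
  | 1 => by unfold hermiteH; fun_prop
  | (n + 2) => by
    have h1 := hermiteH_cont (n + 1)
    have h2 := hermiteH_cont n
    unfold hermiteH; fun_prop

lemma hermiteH_bound : ∀ (l : ℕ) (e : ℝ), 0 < e →
    ∃ K : ℝ, 0 ≤ K ∧ ∀ x, |hermiteH l x| ≤ K * Real.exp (e * x ^ 2) := by
  have hx : ∀ e : ℝ, 0 < e → ∀ x : ℝ, |x| ≤ (1 + 1 / e) * Real.exp (e * x ^ 2) := by
    intro e he x
    have h1 := Real.add_one_le_exp (e * x ^ 2)
    have h2 : |x| ≤ 1 + x ^ 2 := by nlinarith [sq_nonneg (|x| - 1), sq_abs x, abs_nonneg x]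
    have h3 : (1 + 1 / e) * (e * x ^ 2 + 1) = e * x ^ 2 + 1 + x ^ 2 + 1 / e := by field_simp; ring
    have h4 : (1 + 1 / e) * (e * x ^ 2 + 1) ≤ (1 + 1 / e) * Real.exp (e * x ^ 2) := by gcongr
    have h5 : 0 ≤ e * x ^ 2 := by positivity
    have h6 : 0 < 1 / e := by positivity
    linarith
  intro l
  induction l using Nat.twoStepInduction with
  | zero =>
    intro e he
    refine ⟨1, zero_le_one, fun x => ?_⟩
    simp only [hermiteH, abs_one, one_mul]
    exact Real.one_le_exp (by positivity)
  | one =>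
    intro e he
    refine ⟨2 * (1 + 1 / e), by positivity, fun x => ?_⟩
    simp only [hermiteH, abs_mul, abs_two, mul_assoc]
    have := hx e he x
    linarith
  | more n ih0 ih1 =>
    intro e he
    obtain ⟨K0, hK0, h0⟩ := ih0 e he
    obtain ⟨K1, hK1, h1⟩ := ih1 (e / 2) (by positivity)
    refine ⟨2 * (1 + 1 / (e / 2)) * K1 + 2 * (n + 1) * K0, by positivity, fun x => ?_⟩
    simp only [hermiteH]
    have hE : Real.exp (e * x ^ 2) = Real.exp (e / 2 * x ^ 2) * Real.exp (e / 2 * x ^ 2) := by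
      rw [← Real.exp_add]; congr 1; ring
    calc |2 * x * hermiteH (n + 1) x - 2 * (n + 1) * hermiteH n x|
        ≤ |2 * x * hermiteH (n + 1) x| + |2 * (n + 1) * hermiteH n x| := abs_sub _ _
      _ = 2 * (|x| * |hermiteH (n + 1) x|) + 2 * (n + 1) * |hermiteH n x| := by
          rw [abs_mul, abs_mul, abs_two, abs_mul, abs_of_nonneg (by positivity : (0:ℝ) ≤ 2 * (n+1))]
          ring
      _ ≤ 2 * (((1 + 1 / (e / 2)) * Real.exp (e / 2 * x ^ 2)) * (K1 * Real.exp (e / 2 * x ^ 2)))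
          + 2 * (n + 1) * (K0 * Real.exp (e * x ^ 2)) := by
          gcongr
          · exact hx _ (by positivity) x
          · exact h1 x
          · exact h0 x
      _ = _ := by rw [hE]; ring

lemma psi_bound (l : ℕ) : ∃ K : ℝ, 0 ≤ K ∧ ∀ x, ψho l x ^ 2 ≤ K * Real.exp (-(1/2) * x ^ 2) := by
  obtain ⟨K, hK, h⟩ := hermiteH_bound l (1/4) (by norm_num)
  refine ⟨K ^ 2 / (2 ^ l * (Nat.factorial l)) * (Real.sqrt π)⁻¹, by positivity, fun x => ?_⟩
  rw [psi_sq]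
  have h1 : hermiteH l x ^ 2 ≤ K ^ 2 * Real.exp (1/2 * x ^ 2) := by
    rw [← sq_abs]
    calc |hermiteH l x| ^ 2 ≤ (K * Real.exp (1/4 * x ^ 2)) ^ 2 := by gcongr; exact h x
      _ = _ := by
        rw [mul_pow, ← Real.exp_nat_mul]; congr 2; push_cast; ring
  have h2 : Real.exp (-(1/2) * x ^ 2) = Real.exp (1/2 * x ^ 2) * Real.exp (-x ^ 2) := by
    rw [← Real.exp_add]; congr 1; ring
  calc _ ≤ (K ^ 2 * Real.exp (1/2 * x ^ 2)) / (2 ^ l * (Nat.factorial l)) *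
        ((Real.sqrt π)⁻¹ * Real.exp (-x ^ 2)) := by gcongr
    _ = _ := by rw [h2]; ring

lemma dens_cont (d M : ℕ) : Continuous (fermiDensity d M) := by
  unfold fermiDensity ψho
  have := hermiteH_cont
  fun_prop

lemma dens_nonneg (d M : ℕ) (x) : 0 ≤ fermiDensity d M x := by
  unfold fermiDensity; positivity

lemma dens_bound (d M : ℕ) :
    ∃ K : ℝ, ∀ x, fermiDensity d M x ≤ K * Real.exp (-(1/2) * ‖x‖ ^ 2) := by
  choose K hK h using psi_bound
  refine ⟨∑ l ∈ Finset.filter (fun l => ∑ j, l j ≤ M)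
      (Fintype.piFinset fun _ : Fin d => Finset.range (M + 1)), ∏ j, K (l j), fun x => ?_⟩
  rw [fermiDensity, Finset.sum_mul]
  refine Finset.sum_le_sum fun l _ => ?_
  calc ∏ j, ψho (l j) (x j) ^ 2 ≤ ∏ j, (K (l j) * Real.exp (-(1/2) * x j ^ 2)) :=
        Finset.prod_le_prod (fun _ _ => sq_nonneg _) (fun j _ => h _ _)
    _ = _ := by
      rw [Finset.prod_mul_distrib, ← Real.exp_sum, ← Finset.mul_sum,
        EuclideanSpace.real_norm_sq_eq]

lemma gauss_integrand (d : ℕ) (hd : 1 ≤ d) (b s : ℝ) :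
    Set.EqOn (fun y : ℝ => y ^ (d - 1) • (y ^ (2 * s) * Real.exp (-b * y ^ 2)))
      (fun y : ℝ => y ^ (2 * s + d - 1) * Real.exp (-b * y ^ 2)) (Set.Ioi 0) := by
  intro y hy
  have hy : 0 < y := hy
  simp only [smul_eq_mul]
  rw [← mul_assoc, ← Real.rpow_natCast, ← Real.rpow_add hy, Nat.cast_sub hd]
  congr 2; push_cast; ring

lemma gauss_int (d : ℕ) (hd : 1 ≤ d) (b s : ℝ) (hb : 0 < b) (hs : -(d : ℝ) / 2 < s) :
    Integrable (fun x : EuclideanSpace ℝ (Fin d) => ‖x‖ ^ (2 * s) * Real.exp (-b * ‖x‖ ^ 2)) := by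
  have : Nonempty (Fin d) := ⟨⟨0, hd⟩⟩
  have := integrable_fun_norm_addHaar (volume : Measure (EuclideanSpace ℝ (Fin d)))
    (f := fun y => y ^ (2 * s) * Real.exp (-b * y ^ 2))
  rw [this, finrank_euclideanSpace, Fintype.card_fin,
    integrableOn_congr_fun (gauss_integrand d hd b s) measurableSet_Ioi]
  exact integrableOn_rpow_mul_exp_neg_mul_sq hb (by linarith)

lemma gauss_val (d : ℕ) (hd : 1 ≤ d) (s : ℝ) (hs : -(d : ℝ) / 2 < s) :
    ∫ x : EuclideanSpace ℝ (Fin d), ‖x‖ ^ (2 * (s + 1)) * Real.exp (-1 * ‖x‖ ^ 2) =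
     (s + d / 2) * ∫ x : EuclideanSpace ℝ (Fin d), ‖x‖ ^ (2 * s) * Real.exp (-1 * ‖x‖ ^ 2) := by
  have : Nonempty (Fin d) := ⟨⟨0, hd⟩⟩
  have key : ∀ s : ℝ, -(d : ℝ) / 2 < s →
      ∫ y in Set.Ioi (0:ℝ), y ^ (d - 1) • (y ^ (2 * s) * Real.exp (-1 * y ^ 2)) =
      1 / 2 * Real.Gamma (s + d / 2) := by
    intro s hs
    rw [setIntegral_congr_fun measurableSet_Ioi (gauss_integrand d hd 1 s)]
    have := integral_rpow_mul_exp_neg_mul_rpow (p := 2) (q := 2 * s + d - 1) (b := 1) two_pos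
      (by linarith) one_pos
    simp only [Real.rpow_two, Real.one_rpow] at this
    rw [this]
    rw [one_mul]
    congr 2; ring
  have h := fun s : ℝ => integral_fun_norm_addHaar (volume : Measure (EuclideanSpace ℝ (Fin d)))
    (fun y => y ^ (2 * s) * Real.exp (-1 * y ^ 2))
  rw [h, h, finrank_euclideanSpace, Fintype.card_fin, key _ hs, key _ (by linarith)]
  rw [show s + 1 + (d:ℝ)/2 = (s + d / 2) + 1 by ring, Real.Gamma_add_one (by linarith)]
  simp only [smul_eq_mul, nsmul_eq_mul]
  ring

lemma dens_integrable (d : ℕ) (hd : 1 ≤ d) (M : ℕ) (s : ℝ) (hs : -(d : ℝ) / 2 < s) :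
    Integrable (fun x : EuclideanSpace ℝ (Fin d) => ‖x‖ ^ (2 * s) * fermiDensity d M x) := by
  obtain ⟨K, hK⟩ := dens_bound d M
  refine ((gauss_int d hd (1/2) s (by norm_num) hs).const_mul K).mono' ?_ ?_
  · apply Measurable.aestronglyMeasurable
    have := (dens_cont d M).measurable
    fun_prop
  · filter_upwards with x
    have h1 := dens_nonneg d M x
    rw [Real.norm_of_nonneg (by positivity)]
    have := mul_le_mul_of_nonneg_left (hK x) (by positivity : 0 ≤ ‖x‖ ^ (2 * s))
    linarith

lemma dens_zero (d : ℕ) (x) :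
    fermiDensity d 0 x = ((Real.sqrt π)⁻¹) ^ d * Real.exp (-1 * ‖x‖ ^ 2) := by
  rw [← coeff_Fser, Fser]
  simp only [PowerSeries.coeff_zero_eq_constantCoeff, map_mul, map_prod]
  simp only [← PowerSeries.coeff_zero_eq_constantCoeff, gser, PowerSeries.coeff_mk, psi_sq,
    hermiteH]
  rw [EuclideanSpace.real_norm_sq_eq, Finset.mul_sum, Real.exp_sum]
  simp [Finset.prod_mul_distrib]

open PowerSeries in
noncomputable def Jser (d : ℕ) (s : ℝ) : PowerSeries ℝ :=
  PowerSeries.mk fun M => ∫ x : EuclideanSpace ℝ (Fin d), ‖x‖ ^ (2 * s) * fermiDensity d M x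

open PowerSeries in
lemma coeff_mul_Jser (d : ℕ) (hd : 1 ≤ d) (s : ℝ) (hs : -(d : ℝ) / 2 < s) (p : PowerSeries ℝ)
    (n : ℕ) : Integrable (fun x => ‖x‖ ^ (2 * s) * coeff n (p * Fser d x)) ∧
    coeff n (p * Jser d s) = ∫ x, ‖x‖ ^ (2 * s) * coeff n (p * Fser d x) := by
  have e : ∀ x : EuclideanSpace ℝ (Fin d), ‖x‖ ^ (2 * s) * coeff n (p * Fser d x) =
      ∑ ij ∈ Finset.HasAntidiagonal.antidiagonal n, coeff ij.1 p * (‖x‖ ^ (2 * s) * fermiDensity d ij.2 x) := by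
    intro x
    rw [coeff_mul, Finset.mul_sum]
    refine Finset.sum_congr rfl fun ij _ => ?_
    rw [coeff_Fser]; ring
  simp_rw [e]
  have hi : ∀ ij ∈ Finset.HasAntidiagonal.antidiagonal n, Integrable (fun x : EuclideanSpace ℝ (Fin d) =>
      coeff ij.1 p * (‖x‖ ^ (2 * s) * fermiDensity d ij.2 x)) := fun ij _ =>
    (dens_integrable d hd ij.2 s hs).const_mul _
  refine ⟨integrable_finsetSum _ hi, ?_⟩
  rw [integral_finsetSum _ hi, coeff_mul]
  refine Finset.sum_congr rfl fun ij _ => ?_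
  rw [integral_const_mul, Jser, coeff_mk]

open PowerSeries in
lemma coeff_mul_dJser (d : ℕ) (s : ℝ) (hd : 1 ≤ d) (hs : -(d : ℝ) / 2 < s) (p : PowerSeries ℝ)
    (n : ℕ) : 
    coeff n (p * d⁄dX ℝ (Jser d s)) = ∫ x, ‖x‖ ^ (2 * s) * coeff n (p * d⁄dX ℝ (Fser d x)) := by
  have e : ∀ x : EuclideanSpace ℝ (Fin d), ‖x‖ ^ (2 * s) * coeff n (p * d⁄dX ℝ (Fser d x)) =
      ∑ ij ∈ Finset.HasAntidiagonal.antidiagonal n, (coeff ij.1 p * (ij.2 + 1)) *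
        (‖x‖ ^ (2 * s) * fermiDensity d (ij.2 + 1) x) := by
    intro x
    rw [coeff_mul, Finset.mul_sum]
    refine Finset.sum_congr rfl fun ij _ => ?_
    rw [coeff_derivative, coeff_Fser]; ring
  simp_rw [e]
  have hi : ∀ ij ∈ Finset.HasAntidiagonal.antidiagonal n, Integrable (fun x : EuclideanSpace ℝ (Fin d) =>
      (coeff ij.1 p * (ij.2 + 1)) * (‖x‖ ^ (2 * s) * fermiDensity d (ij.2 + 1) x)) := fun ij _ =>
    (dens_integrable d hd _ s hs).const_mul _
  rw [integral_finsetSum _ hi, coeff_mul]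
  refine Finset.sum_congr rfl fun ij _ => ?_
  rw [integral_const_mul, Jser, coeff_derivative, coeff_mk]; ring

open PowerSeries in
lemma Jser_ode (d : ℕ) (hd : 1 ≤ d) (s : ℝ) (hs : -(d : ℝ) / 2 < s) :
    (1 - X) * (1 + X) ^ 2 * d⁄dX ℝ (Jser d s) =
      ((d : PowerSeries ℝ) * (X * (1 + X)) + (1 + X) ^ 2) * Jser d s
       + C 2 * (1 - X) * Jser d (s + 1) := by
  have : Nonempty (Fin d) := ⟨⟨0, hd⟩⟩
  ext n
  obtain ⟨i1, h1⟩ := coeff_mul_Jser d hd s hs ((d : PowerSeries ℝ) * (X * (1 + X)) + (1 + X) ^ 2) n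
  obtain ⟨i2, h2⟩ := coeff_mul_Jser d hd (s + 1) (by linarith) (C 2 * (1 - X)) n
  rw [coeff_mul_dJser d s hd hs, map_add, h1, h2, ← integral_add i1 i2]
  refine integral_congr_ae ?_
  filter_upwards [Measure.ae_ne volume (0 : EuclideanSpace ℝ (Fin d))] with x hx
  have hx : 0 < ‖x‖ := norm_pos_iff.mpr hx
  rw [Fser_ode, map_add, mul_add]
  congr 1
  rw [show C 2 * (1 - X) * (C (‖x‖ ^ 2) * Fser d x) = C (‖x‖ ^ 2) * (C 2 * (1 - X) * Fser d x) by
    ring, coeff_C_mul, mul_add (2:ℝ), mul_one, Real.rpow_add hx, Real.rpow_two]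
  ring

open PowerSeries in
lemma Jser_rel (d : ℕ) (hd : 1 ≤ d) (s : ℝ) (hs : -(d : ℝ) / 2 < s) :
    (1 - X) * Jser d (s + 1) = C (s + d / 2) * (1 + X) * Jser d s := by
  have := vanish (-(d : ℝ) / 2)
    (fun s => (1 - X) * Jser d (s + 1) - C (s + d / 2) * (1 + X) * Jser d s)
    ((d : PowerSeries ℝ) * (X * (1 + X)) + (1 + X) ^ 2 + (1 - X) * (1 + X)) ?_ ?_ s hs
  · exact sub_eq_zero.mp this
  · intro s hs
    have h := gauss_val d hd s hs
    simp only [map_sub, map_mul, map_add, map_one, constantCoeff_X, constantCoeff_C, sub_zero,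
      add_zero, one_mul, mul_one]
    simp only [← coeff_zero_eq_constantCoeff, Jser, coeff_mk, dens_zero, mul_left_comm _ (_ ^ d) _]
    rw [integral_const_mul, integral_const_mul, h]
    ring
  · intro s hs
    have h1 := Jser_ode d hd s hs
    have h2 := Jser_ode d hd (s + 1) (by linarith)
    have hC : (C (s + 1 + d / 2) : PowerSeries ℝ) = C (s + d / 2) + 1 := by
      rw [show s + 1 + (d:ℝ) / 2 = (s + d / 2) + 1 by ring, map_add, map_one]
    have h2C : (C (2:ℝ) : PowerSeries ℝ) = 2 := map_ofNat C 2
    simp only [map_sub, map_add, Derivation.leibniz, smul_eq_mul, derivative_C, derivative_X,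
      derivative_one, hC] at *
    simp only [h2C] at *
    linear_combination (1 - X) * h2 - (C s + C ((d:ℝ) / 2)) * (1 + X) * h1

open PowerSeries in
lemma Jser_final (d : ℕ) (hd : 1 ≤ d) (k : ℝ) (hk : 1 - (d : ℝ) / 2 < k) :
    C (k + d + 1) * Jser d (k + 1) = C (k + d / 2) * (2 * (X * d⁄dX ℝ (Jser d k))
      + C (d + 1 : ℝ) * Jser d k + C (k * (k + d / 2 - 1)) * Jser d (k - 1)) := by
  have h0 := Jser_ode d hd k (by linarith)
  have h1 := Jser_rel d hd k (by linarith)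
  have h2 := Jser_rel d hd (k - 1) (by linarith)
  rw [sub_add_cancel] at h2
  have n1 : (1 - X : PowerSeries ℝ) ≠ 0 := fun h => by
    have := congrArg constantCoeff h; simp at this
  have n2 : (1 + X : PowerSeries ℝ) ≠ 0 := fun h => by
    have := congrArg constantCoeff h; simp at this
  have hdC : (d : PowerSeries ℝ) = C (d : ℝ) := (map_natCast C d).symm
  have hhalf : (C (d : ℝ) : PowerSeries ℝ) = 2 * C ((d : ℝ) / 2) := by
    rw [show (2 : PowerSeries ℝ) = C (2:ℝ) from (map_ofNat C 2).symm, ← map_mul]; congr 1; ring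
  have h2C : (C (2:ℝ) : PowerSeries ℝ) = 2 := map_ofNat C 2
  apply mul_left_cancel₀ (mul_ne_zero n1 (pow_ne_zero 2 n2))
  rw [hdC] at h0
  simp only [map_add, map_sub, map_mul, map_one, hhalf, h2C] at *
  linear_combination (1 + X) ^ 2 * (C k + 2 * C ((d:ℝ)/2) + 1) * h1
    - (C k + C ((d:ℝ)/2)) * 2 * X * (h0 + 2 * h1)
    + (C k + C ((d:ℝ)/2)) * C k * (1 - X) * (1 + X) * h2

/-- the real-exponent normalised moments
`m_{2s} = (1/N₀)∫ ‖x‖^{2s} ρ^{M,d}(x) dx` converge for real `s > -d/2` and satisfy,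
for real `k > 1 - d/2`, the second order recurrence
`(2(k+d+1)/(2k+d)) m_{2k+2} = (2M+d+1) m_{2k} + k(k+d/2-1) m_{2k-2}`. -/
theorem fermi_moment_recurrence_real_exponent (d M : ℕ) (hd : 1 ≤ d)
    (k : ℝ) (hk : 1 - (d : ℝ) / 2 < k)
    (m : ℝ → ℝ)
    (hm : ∀ s : ℝ, m s = (1 / (Nat.choose (M + d) d : ℝ)) *
        ∫ x : EuclideanSpace ℝ (Fin d), ‖x‖ ^ (2 * s) * fermiDensity d M x) :
    (∀ s : ℝ, -(d : ℝ) / 2 < s →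
        Integrable (fun x : EuclideanSpace ℝ (Fin d) => ‖x‖ ^ (2 * s) * fermiDensity d M x)) ∧
      (2 * (k + (d : ℝ) + 1) / (2 * k + (d : ℝ))) * m (k + 1) =
        (2 * (M : ℝ) + (d : ℝ) + 1) * m k + k * (k + (d : ℝ) / 2 - 1) * m (k - 1) := by
  refine ⟨fun s hs => dens_integrable d hd M s hs, ?_⟩
  have h := congrArg (PowerSeries.coeff M) (Jser_final d hd k hk)
  have hX : PowerSeries.coeff M (2 * (PowerSeries.X * PowerSeries.derivative ℝ (Jser d k))) =
      2 * (M * PowerSeries.coeff M (Jser d k)) := by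
    rw [show (2 : PowerSeries ℝ) = PowerSeries.C (2:ℝ) from (map_ofNat PowerSeries.C 2).symm, PowerSeries.coeff_C_mul]
    rcases M with _ | M
    · simp
    · rw [PowerSeries.coeff_succ_X_mul, PowerSeries.coeff_derivative]; push_cast; ring
  rw [PowerSeries.coeff_C_mul, PowerSeries.coeff_C_mul, map_add, map_add, hX,
    PowerSeries.coeff_C_mul, PowerSeries.coeff_C_mul] at h
  simp only [Jser, PowerSeries.coeff_mk] at h
  rw [hm, hm, hm]
  have ha : 2 * k + (d:ℝ) ≠ 0 := by linarith
  rw [div_mul_eq_mul_div, div_eq_iff ha]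
  linear_combination (2 / (Nat.choose (M + d) d : ℝ)) * h
end

section
/- For every integer d ≥ 1 and integer M ≥ 0, with M̃ = M + (d+1)/2, the second and fourth normalised radial moments of the ground-state density evaluate to m_2^{N_0,d} = d M̃ / (d+1) and m_4^{N_0,d} = (d/(d+1)) ( M̃² + (d+1)/4 ). -/
open MeasureTheory Real

open Polynomial in
noncomputable def HP : ℕ → ℝ[X]
  | 0 => 1
  | (n + 1) => 2 * X * HP n - derivative (HP n)

open Polynomial in
lemma HP_deriv (n : ℕ) : derivative (HP (n+1)) = 2 * ((n:ℝ[X])+1) * HP n := by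
  induction n with
  | zero => simp [HP, derivative_mul]
  | succ n ih =>
    rw [HP, derivative_sub, ih]
    have h2 : derivative (2 * ((n:ℝ[X])+1) * HP n) = 2 * ((n:ℝ[X])+1) * derivative (HP n) := by
      rw [derivative_mul, derivative_mul]; simp
    rw [h2, derivative_mul, derivative_mul, ih]
    simp only [derivative_X, derivative_ofNat]
    rw [show HP (n+1) = 2 * X * HP n - derivative (HP n) from rfl]
    push_cast; ring

lemma HP_eval (n : ℕ) (x : ℝ) : (HP n).eval x = hermiteH n x ∧
    (HP (n+1)).eval x = hermiteH (n+1) x := by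
  induction n with
  | zero => simp [HP, hermiteH]
  | succ n ih =>
    refine ⟨ih.2, ?_⟩
    rw [HP, HP_deriv]
    simp [hermiteH, ih.1, ih.2]

open Polynomial in
lemma integ (p : ℝ[X]) : Integrable (fun x : ℝ => p.eval x * exp (-x^2)) := by
  induction p using Polynomial.induction_on' with
  | add p q hp hq => 
    refine (hp.add hq).congr (Filter.Eventually.of_forall fun x => ?_)
    simp [add_mul]
  | monomial n a =>
    have h := (integrable_rpow_mul_exp_neg_mul_sq (b := 1) one_pos (s := (n:ℝ))
      (by have : (0:ℝ) ≤ n := n.cast_nonneg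
          linarith)).const_mul a
    refine h.congr (Filter.Eventually.of_forall fun x => ?_)
    simp [mul_assoc]

open Polynomial in
noncomputable def LL (p : ℝ[X]) : ℝ := ∫ x : ℝ, p.eval x * exp (-x^2)

open Polynomial in
lemma LL_add (p q : ℝ[X]) : LL (p+q) = LL p + LL q := by
  unfold LL
  rw [← integral_add (integ p) (integ q)]
  simp [add_mul]

open Polynomial in
lemma LL_smul (a : ℝ) (p : ℝ[X]) : LL (C a * p) = a * LL p := by
  unfold LL
  rw [← integral_const_mul]
  simp [mul_assoc]

open Polynomial in
lemma LL_parts (p : ℝ[X]) : LL (derivative p) = LL (2 * X * p) := by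
  have h : LL (derivative p + C (-1) * (2 * X * p)) = 0 := by
    unfold LL
    refine integral_eq_zero_of_hasDerivAt_of_integrable (f := fun x => p.eval x * exp (-x^2)) ?_ (integ _) (integ _)
    intro x
    have h1 := p.hasDerivAt x
    have h2 : HasDerivAt (fun x : ℝ => exp (-x^2)) (exp (-x^2) * (-(2*x))) x := by
      have := ((hasDerivAt_pow 2 x).neg).exp
      simpa using this
    refine (h1.mul h2).congr_deriv ?_
    simp only [eval_add, eval_mul, eval_C, eval_X, eval_ofNat]; ring
  rw [LL_add, LL_smul] at h
  linarith

open Polynomial in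
lemma LL_step (n : ℕ) (q : ℝ[X]) : LL (HP (n+1) * q) = LL (HP n * derivative q) := by
  have h := LL_parts (HP n * q)
  rw [derivative_mul, LL_add] at h
  have : 2 * X * (HP n * q) = HP (n+1) * q + derivative (HP n) * q := by
    rw [HP]; ring
  rw [this, LL_add] at h
  linarith

lemma LL_one : LL 1 = √π := by
  have := integral_gaussian 1
  simpa [LL] using this

open Polynomial in
lemma LL_succ (m n : ℕ) : LL (HP (m+1) * HP (n+1)) = 2 * (n+1) * LL (HP m * HP n) := by
  rw [LL_step, HP_deriv, ← LL_smul]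
  congr 1
  rw [show C (2 * ((n:ℝ)+1)) = 2 * ((n:ℝ[X])+1) by simp [show C (2:ℝ) = 2 from rfl]]
  ring

lemma LL_ne0 (m : ℕ) : LL (HP (m+1) * HP 0) = 0 := by
  rw [LL_step]; simp [HP, LL]

lemma LL_ne (m k : ℕ) : LL (HP (m+k+1) * HP m) = 0 := by
  induction m with
  | zero => exact LL_ne0 _
  | succ m ih => 
    rw [show m+1+k+1 = (m+k+1)+1 by ring, LL_succ, ih, mul_zero]

lemma LL_ne' (m k : ℕ) : LL (HP m * HP (m+k+1)) = 0 := by rw [mul_comm, LL_ne]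

noncomputable def hh (n : ℕ) : ℝ := 2^n * n.factorial * √π

lemma LL_eq (n : ℕ) : LL (HP n * HP n) = hh n := by
  induction n with
  | zero => simp [HP, LL_one, hh]
  | succ n ih => rw [LL_succ, ih, hh, hh, Nat.factorial_succ]; push_cast; ring

open Polynomial in
lemma X_mul_HP (n : ℕ) : X * HP (n+1) = C (1/2) * HP (n+2) + C ((n:ℝ)+1) * HP n := by
  rw [show HP (n+2) = 2 * X * HP (n+1) - derivative (HP (n+1)) from rfl, HP_deriv]
  have : C (1/2 : ℝ) * 2 = 1 := by
    rw [show (2:ℝ[X]) = C 2 from rfl, ← C_mul]; norm_num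
  have h2 : C ((n:ℝ)+1) = (n:ℝ[X]) + 1 := by simp
  rw [h2]
  linear_combination (-X * HP (n+1) + (n+1) * HP n) * this

open Polynomial in
lemma X_mul_HP0 : X * HP 0 = C (1/2) * HP 1 := by
  have : C (1/2 : ℝ) * 2 = 1 := by
    rw [show (2:ℝ[X]) = C 2 from rfl, ← C_mul]; norm_num
  simp only [HP]; simp
  rw [← one_div]; linear_combination -X * this

open Polynomial in
lemma LL_X2 (n : ℕ) : LL (X^2 * (HP n * HP n)) = (n + 1/2) * hh n := by
  cases n with
  | zero =>
    rw [show X^2 * (HP 0 * HP 0) = (X * HP 0) * (X * HP 0) by ring, X_mul_HP0,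
      show C (1/2) * HP 1 * (C (1/2) * HP 1) = C (1/2) * (C (1/2) * (HP 1 * HP 1)) by ring,
      LL_smul, LL_smul, LL_eq]
    simp [hh]
  | succ n =>
    rw [show X^2 * (HP (n+1) * HP (n+1)) = (X * HP (n+1)) * (X * HP (n+1)) by ring, X_mul_HP]
    rw [show (C (1/2) * HP (n+2) + C ((n:ℝ)+1) * HP n) * (C (1/2) * HP (n+2) + C ((n:ℝ)+1) * HP n)
      = C (1/2) * (C (1/2) * (HP (n+2) * HP (n+2))) + C ((n:ℝ)+1) * (HP (n+2) * HP n) +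
       C ((n:ℝ)+1) * (C ((n:ℝ)+1) * (HP n * HP n)) by
        have : C (1/2 : ℝ) * 2 = 1 := by
          rw [show (2:ℝ[X]) = C 2 from rfl, ← C_mul]; norm_num
        linear_combination (C ((n:ℝ)+1) * HP (n+2) * HP n) * this]
    simp only [LL_add, LL_smul, LL_eq, LL_ne n 1]
    simp only [hh, Nat.factorial_succ]; push_cast; ring

open Polynomial in
lemma LL_sq3 (a b c : ℝ) (p q r : ℝ[X]) (h1 : LL (p * q) = 0) (h2 : LL (p * r) = 0)
   (h3 : LL (q * r) = 0) : LL ((C a * p + C b * q + C c * r)^2) =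
    a^2 * LL (p*p) + b^2 * LL (q*q) + c^2 * LL (r*r) := by
  rw [show (C a * p + C b * q + C c * r)^2 = C (a^2) * (p*p) + C (b^2) * (q*q) + C (c^2) * (r*r)
     + C (2*a*b) * (p * q) + C (2*a*c) * (p*r) + C (2*b*c) * (q*r) by
      simp only [C_mul, C_pow, show C (2:ℝ) = 2 from rfl]; ring]
  simp only [LL_add, LL_smul, h1, h2, h3]; ring

open Polynomial in
lemma LL_X4 (n : ℕ) : LL (X^4 * (HP n * HP n)) = (3/4*(2*n^2+2*n+1)) * hh n := by
  match n with
  | 0 =>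
    have e : X^4 * (HP 0 * HP 0) = (C (1/4) * HP 2 + C (1/2) * HP 0 + C 0 * HP 0)^2 := by
      have : X * (X * HP 0) = C (1/4) * HP 2 + C (1/2) * HP 0 + C 0 * HP 0 := by
        rw [X_mul_HP0, mul_left_comm, X_mul_HP, mul_add, ← mul_assoc, ← mul_assoc, ← C_mul, ← C_mul]
        norm_num
      rw [← this]; ring
    have e2 : X^4 * (HP 0 * HP 0) = (C (1/4) * HP 2 + C (1/2) * HP 0 + C 0 * HP 1)^2 := by
      rw [e]; simp
    rw [e2, LL_sq3 _ _ _ _ _ _ (LL_ne 0 1) (LL_ne 1 0) (LL_ne' 0 0)]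
    simp only [LL_eq, hh, Nat.factorial]; push_cast; ring
  | 1 =>
    have e : X * (X * HP 1) = C (1/4) * HP 3 + C (3/2) * HP 1 + C 0 * HP 0 := by
      rw [X_mul_HP, mul_add, mul_left_comm, X_mul_HP, mul_left_comm, X_mul_HP0, mul_add,
        ← mul_assoc, ← mul_assoc, ← mul_assoc, ← C_mul, ← C_mul, ← C_mul, add_assoc, ← add_mul, ← C_add]
      norm_num
    rw [show X^4 * (HP 1 * HP 1) = (X * (X * HP 1))^2 by ring, e,
      LL_sq3 _ _ _ _ _ _ (LL_ne 1 1) (LL_ne 0 2) (LL_ne 0 0)]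
    simp only [LL_eq, hh, Nat.factorial]; push_cast; ring
  | (n+2) =>
    have e : X * (X * HP (n+2)) = C (1/4) * HP (n+4) + C ((n:ℝ)+2+1/2) * HP (n+2)
        + C (((n:ℝ)+2)*(n+1)) * HP n := by
      rw [X_mul_HP, mul_add, mul_left_comm, X_mul_HP, mul_left_comm, X_mul_HP, mul_add, mul_add,
        ← mul_assoc, ← mul_assoc, ← mul_assoc, ← mul_assoc, ← C_mul, ← C_mul, ← C_mul, ← C_mul]
      rw [show C ((n:ℝ)+2+1/2) = C (1 / 2 * (((n + 1 + 1:ℕ):ℝ) + 1)) + C ((((n + 1:ℕ):ℝ) + 1) * (1/2)) by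
        rw [← C_add]; congr 1; push_cast; ring,
        show ((n:ℝ)+2)*(n+1) = (((n + 1:ℕ):ℝ) + 1) * (n+1) by push_cast; ring,
        show (1:ℝ)/4 = 1/2*(1/2) by norm_num]
      ring
    rw [show X^4 * (HP (n+2) * HP (n+2)) = (X * (X * HP (n+2)))^2 by ring, e,
      LL_sq3 _ _ _ _ _ _ (LL_ne (n+2) 1) (LL_ne n 3) (LL_ne n 1)]
    simp only [LL_eq, hh, Nat.factorial_succ]; push_cast; ring

lemma hh_pos (n : ℕ) : 0 < hh n := by unfold hh; positivity

open Polynomial in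
lemma psi_eq (n k : ℕ) (x : ℝ) : x^k * ψho n x ^ 2 =
    (hh n)⁻¹ * ((X^k * (HP n * HP n)).eval x * exp (-x^2)) := by
  unfold ψho
  rw [mul_pow, mul_pow, inv_pow, Real.sq_sqrt (show 0 ≤ 2 ^ n * (n.factorial : ℝ) * √π from (hh_pos n).le), ← Real.exp_nat_mul]
  simp only [eval_mul, eval_pow, eval_X, (HP_eval n x).1, hh]
  rw [show ((2:ℕ):ℝ) * (-x^2/2) = -x^2 by push_cast; ring]
  ring

lemma psi_int (n k : ℕ) : Integrable (fun x : ℝ => x^k * ψho n x ^ 2) := by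
  simp_rw [psi_eq]; exact (integ _).const_mul _

/-- moments -/
noncomputable def am (n k : ℕ) : ℝ := ∫ x : ℝ, x^(2*k) * ψho n x ^ 2

open Polynomial in
lemma am_eq (n k : ℕ) : am n k = (hh n)⁻¹ * LL (X^(2*k) * (HP n * HP n)) := by
  unfold am LL; simp_rw [psi_eq]; rw [integral_const_mul]

lemma am0 (n : ℕ) : am n 0 = 1 := by
  rw [am_eq]; simp [LL_eq, (hh_pos n).ne']
lemma am1 (n : ℕ) : am n 1 = n + 1/2 := by
  rw [am_eq, LL_X2]; field_simp [(hh_pos n).ne']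
lemma am2 (n : ℕ) : am n 2 = 3/4*(2*n^2+2*n+1) := by
  rw [am_eq, LL_X4]; field_simp [(hh_pos n).ne']

lemma pi_int {d : ℕ} (l e : Fin d → ℕ) :
    Integrable (fun x : Fin d → ℝ => ∏ j, (x j ^ (2 * e j) * ψho (l j) (x j) ^ 2)) :=
  Integrable.fintype_prod (f := fun j y => y ^ (2 * e j) * ψho (l j) y ^ 2) fun j => psi_int _ _

lemma pi_integral {d : ℕ} (l e : Fin d → ℕ) :
    ∫ x : Fin d → ℝ, ∏ j, (x j ^ (2 * e j) * ψho (l j) (x j) ^ 2) = ∏ j, am (l j) (e j) :=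
  integral_fintype_prod_volume_eq_prod (fun j y => y ^ (2 * e j) * ψho (l j) y ^ 2)

lemma mono1 {d : ℕ} (l : Fin d → ℕ) (i : Fin d) (x : Fin d → ℝ) :
    x i ^ 2 * ∏ j, ψho (l j) (x j) ^ 2
      = ∏ j, (x j ^ (2 * (Pi.single i 1 : Fin d → ℕ) j) * ψho (l j) (x j) ^ 2) := by
  rw [Finset.prod_mul_distrib]
  congr 1
  rw [Finset.prod_eq_single i]
  · simp
  · intro j _ hj; simp [hj]
  · simp

lemma mono2 {d : ℕ} (l : Fin d → ℕ) (i k : Fin d) (x : Fin d → ℝ) :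
    x i ^ 2 * x k ^ 2 * ∏ j, ψho (l j) (x j) ^ 2
      = ∏ j, (x j ^ (2 * (Pi.single i 1 + Pi.single k 1 : Fin d → ℕ) j) * ψho (l j) (x j) ^ 2) := by
  rw [mul_assoc, mono1, Finset.prod_mul_distrib, ← mul_assoc, Finset.prod_mul_distrib]
  congr 1
  simp only [Pi.add_apply, mul_add, pow_add, Finset.prod_mul_distrib]
  congr 1
  rw [Finset.prod_eq_single i]
  · simp
  · intro j _ hj; simp [hj]
  · simp

lemma am_single {d : ℕ} (l : Fin d → ℕ) (i : Fin d) :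
    ∏ j, am (l j) ((Pi.single i 1 : Fin d → ℕ) j) = l i + 1/2 := by
  rw [Finset.prod_eq_single i]
  · simp [am1]
  · intro j _ hj; simp [hj, am0]
  · simp

lemma am_double {d : ℕ} (l : Fin d → ℕ) (i k : Fin d) :
    ∏ j, am (l j) ((Pi.single i 1 + Pi.single k 1 : Fin d → ℕ) j) =
      (l i + 1/2) * (l k + 1/2) + if i = k then (l i:ℝ)^2/2 + l i / 2 + 1/2 else 0 := by
  by_cases h : i = k
  · subst h
    rw [Finset.prod_eq_single i]
    · simp [am2]; ring
    · intro j _ hj; simp [hj, am0]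
    · simp
  · rw [if_neg h, add_zero, ← am_single l i, ← am_single l k, ← Finset.prod_mul_distrib]
    refine Finset.prod_congr rfl fun j _ => ?_
    by_cases hi : j = i
    · subst hi
      simp [h, am0]
    · simp [hi, am0]

lemma int2 {d : ℕ} (l : Fin d → ℕ) :
    Integrable (fun x : Fin d → ℝ => (∑ i, x i ^ 2) * ∏ j, ψho (l j) (x j) ^ 2) ∧
    ∫ x : Fin d → ℝ, (∑ i, x i ^ 2) * ∏ j, ψho (l j) (x j) ^ 2 = ∑ i, (l i:ℝ) + d / 2 := by
  simp_rw [Finset.sum_mul, mono1]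
  refine ⟨integrable_finsetSum _ fun i _ => pi_int _ _, ?_⟩
  rw [integral_finsetSum _ fun i _ => pi_int _ _]
  simp_rw [pi_integral, am_single]
  rw [Finset.sum_add_distrib]
  simp; ring

lemma int4 {d : ℕ} (l : Fin d → ℕ) :
    Integrable (fun x : Fin d → ℝ => (∑ i, x i ^ 2)^2 * ∏ j, ψho (l j) (x j) ^ 2) ∧
    ∫ x : Fin d → ℝ, (∑ i, x i ^ 2)^2 * ∏ j, ψho (l j) (x j) ^ 2 =
      (∑ i, (l i:ℝ) + d / 2)^2 + ((∑ i, (l i:ℝ)^2)/2 + (∑ i, (l i:ℝ))/2 + d/2) := by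
  simp_rw [pow_two (∑ i, _ ^ 2), Finset.sum_mul_sum, Finset.sum_mul, mono2]
  refine ⟨integrable_finsetSum _ fun i _ => integrable_finsetSum _ fun k _ => pi_int _ _, ?_⟩
  rw [integral_finsetSum _ fun i _ => integrable_finsetSum _ fun k _ => pi_int _ _]
  simp_rw [integral_finsetSum _ fun k _ => pi_int _ _, pi_integral, am_double,
    Finset.sum_add_distrib, ← Finset.mul_sum, ← Finset.sum_mul]
  simp [Finset.sum_add_distrib, ← Finset.sum_div]
  ring


def SS (d M : ℕ) : Finset (Fin d → ℕ) := Finset.filter (fun l => ∑ j, l j ≤ M)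
      (Fintype.piFinset fun _ : Fin d => Finset.range (M + 1))

lemma mem_SS (d M : ℕ) (l : Fin d → ℕ) : l ∈ SS d M ↔ ∑ j, l j ≤ M := by
  unfold SS
  rw [Finset.mem_filter, Fintype.mem_piFinset]
  constructor
  · exact fun h => h.2
  · intro h
    refine ⟨fun j => ?_, h⟩
    have := Finset.single_le_sum (f := l) (fun i _ => Nat.zero_le _) (Finset.mem_univ j)
    rw [Finset.mem_range]; omega

lemma sum_SS_zero_left (M : ℕ) (F : (Fin 0 → ℕ) → ℝ) : ∑ l ∈ SS 0 M, F l = F 0 := by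
  have : SS 0 M = {0} := by
    ext l; rw [mem_SS]; simp; exact Subsingleton.elim _ _
  rw [this, Finset.sum_singleton]

lemma sum_SS_zero_right (d : ℕ) (F : (Fin d → ℕ) → ℝ) : ∑ l ∈ SS d 0, F l = F 0 := by
  have : SS d 0 = {0} := by
    ext l; rw [mem_SS]; simp [funext_iff]
  rw [this, Finset.sum_singleton]

lemma sum_SS_succ (d M : ℕ) (F : (Fin (d+1) → ℕ) → ℝ) :
    ∑ l ∈ SS (d+1) (M+1), F l = ∑ l ∈ SS d (M+1), F (Fin.cons 0 l)
      + ∑ l ∈ SS (d+1) M, F (Fin.cons (l 0 + 1) (Fin.tail l)) := by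
  rw [← Finset.sum_filter_add_sum_filter_not _ (fun l => l 0 = 0)]
  congr 1
  · refine Finset.sum_nbij' (fun l => Fin.tail l) (fun l => Fin.cons 0 l) ?_ ?_ ?_ ?_ ?_
    · intro l hl
      simp only [Finset.mem_filter, mem_SS, Fin.sum_univ_succ] at hl ⊢
      simp only [Fin.tail]; omega
    · intro l hl
      simp only [Finset.mem_filter, mem_SS, Fin.sum_univ_succ] at hl ⊢
      simpa using hl
    · intro l hl
      simp only [Finset.mem_filter] at hl
      conv_rhs => rw [← Fin.cons_self_tail l, hl.2]
    · intro l hl; simp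
    · intro l hl
      simp only [Finset.mem_filter] at hl
      conv_lhs => rw [← Fin.cons_self_tail l, hl.2]
  · refine Finset.sum_nbij' (fun l => Fin.cons (l 0 - 1) (Fin.tail l))
      (fun l => Fin.cons (l 0 + 1) (Fin.tail l)) ?_ ?_ ?_ ?_ ?_
    · intro l hl
      simp only [Finset.mem_filter, mem_SS, Fin.sum_univ_succ, Fin.cons_zero, Fin.cons_succ, Fin.tail] at hl ⊢
      omega
    · intro l hl
      simp only [Finset.mem_filter, mem_SS, Fin.sum_univ_succ, Fin.cons_zero, Fin.cons_succ, Fin.tail] at hl ⊢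
      omega
    · intro l hl
      simp only [Finset.mem_filter] at hl
      have : l 0 - 1 + 1 = l 0 := by omega
      simp [this]
    · intro l hl; simp
    · intro l hl
      simp only [Finset.mem_filter] at hl
      have : l 0 - 1 + 1 = l 0 := by omega
      simp [this]

noncomputable def cc (d M : ℕ) : ℝ := (Nat.choose (M + d) d : ℝ)

lemma cc_r1 (d M : ℕ) : cc d (M+1) = ((d:ℝ)+1) / (M+d+2) * cc (d+1) (M+1) := by
  have h := Nat.add_one_mul_choose_eq (M+1+d) d
  have h2 : ((M:ℝ)+1+d+1) * cc d (M+1) = cc (d+1) (M+1) * (d+1) := by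
    unfold cc; exact_mod_cast h
  have : (M:ℝ)+d+2 ≠ 0 := by positivity
  field_simp; linarith

lemma cc_r2 (d M : ℕ) : cc (d+1) M = ((M:ℝ)+1) / (M+d+2) * cc (d+1) (M+1) := by
  have h1 := cc_r1 d M
  have h : cc (d+1) (M+1) = cc d (M+1) + cc (d+1) M := by
    unfold cc
    have := Nat.choose_succ_succ (M+1+d) d
    rw [show M + 1 + (d+1) = (M+1+d)+1 by ring, show M + (d+1) = M+1+d by ring]
    exact_mod_cast this
  have : (M:ℝ)+d+2 ≠ 0 := by positivity
  rw [h1] at h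
  field_simp at h ⊢; linarith

lemma sum_N (d M : ℕ) : ∑ l ∈ SS d M, (1:ℝ) = cc d M := by
  induction d generalizing M with
  | zero => rw [sum_SS_zero_left]; simp [cc]
  | succ d ihd =>
    induction M with
    | zero => rw [sum_SS_zero_right]; simp [cc]
    | succ M ihM =>
      rw [sum_SS_succ, ihd, ihM, cc_r1 d M, cc_r2 d M]
      have : (M:ℝ)+d+2 ≠ 0 := by positivity
      field_simp; ring

lemma sum_Z (d M : ℕ) : ∑ l ∈ SS (d+1) M, (l 0:ℝ) = M / (d+2) * cc (d+1) M := by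
  induction M with
  | zero => rw [sum_SS_zero_right]; simp
  | succ M ihM =>
    rw [sum_SS_succ]
    simp only [Fin.cons_zero, Nat.cast_add, Nat.cast_one, Nat.cast_zero, Finset.sum_const_zero,
      Finset.sum_add_distrib]
    rw [ihM, sum_N, cc_r2 d M]
    have : (M:ℝ)+d+2 ≠ 0 := by positivity
    field_simp; ring

lemma sum_A (d M : ℕ) : ∑ l ∈ SS d M, (∑ i, (l i:ℝ)) = d * M / (d+1) * cc d M := by
  induction d generalizing M with
  | zero => rw [sum_SS_zero_left]; simp
  | succ d ihd =>
    induction M with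
    | zero => rw [sum_SS_zero_right]; simp
    | succ M ihM =>
      have e : ∀ l : Fin (d+1) → ℕ, ((l 0 + 1 : ℕ):ℝ) + ∑ i, (Fin.tail l i : ℝ) = (∑ i, (l i:ℝ)) + 1 := by
        intro l; rw [Fin.sum_univ_succ (n := d)]; simp only [Fin.tail]; push_cast; ring
      rw [sum_SS_succ]
      simp only [Fin.sum_univ_succ (n := d), Fin.cons_zero, Fin.cons_succ, Nat.cast_zero, zero_add]
      simp only [e, Finset.sum_add_distrib]
      rw [ihd, ihM, sum_N, cc_r1 d M, cc_r2 d M]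
      push_cast
      have : (M:ℝ)+d+2 ≠ 0 := by positivity
      field_simp; ring

lemma sum_B (d M : ℕ) : ∑ l ∈ SS d M, (∑ i, (l i:ℝ))^2 =
    (d * (2 * M * (M-1) / ((d+1)*(d+2)) + M/(d+1)) + d * (d-1) * M*(M-1) / ((d+1)*(d+2))) * cc d M := by
  induction d generalizing M with
  | zero => rw [sum_SS_zero_left]; simp
  | succ d ihd =>
    induction M with
    | zero => rw [sum_SS_zero_right]; simp
    | succ M ihM =>
      have e : ∀ l : Fin (d+1) → ℕ, (((l 0 + 1 : ℕ):ℝ) + ∑ i, (Fin.tail l i : ℝ))^2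
          = (∑ i, (l i:ℝ))^2 + ((∑ i, (l i:ℝ)) + (∑ i, (l i:ℝ)) + 1) := by
        intro l; rw [Fin.sum_univ_succ (n := d)]; simp only [Fin.tail]; push_cast; ring
      rw [sum_SS_succ]
      simp only [Fin.sum_univ_succ (n := d), Fin.cons_zero, Fin.cons_succ, Nat.cast_zero, zero_add]
      simp only [e]
      rw [Finset.sum_add_distrib, Finset.sum_add_distrib, Finset.sum_add_distrib]
      rw [ihd, ihM, sum_N, sum_A, cc_r1 d M, cc_r2 d M]
      push_cast
      have : (M:ℝ)+d+2 ≠ 0 := by positivity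
      field_simp; ring

lemma sum_Q (d M : ℕ) : ∑ l ∈ SS d M, (∑ i, (l i:ℝ)^2) =
    (d * (2 * M * (M-1) / ((d+1)*(d+2)) + M/(d+1))) * cc d M := by
  induction d generalizing M with
  | zero => rw [sum_SS_zero_left]; simp
  | succ d ihd =>
    induction M with
    | zero => rw [sum_SS_zero_right]; simp
    | succ M ihM =>
      have e : ∀ l : Fin (d+1) → ℕ, (((l 0 + 1 : ℕ):ℝ))^2 + ∑ i, (Fin.tail l i : ℝ)^2
          = (∑ i, (l i:ℝ)^2) + ((l 0:ℝ) + (l 0:ℝ) + 1) := by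
        intro l; rw [Fin.sum_univ_succ (n := d)]; simp only [Fin.tail]; push_cast; ring
      rw [sum_SS_succ]
      simp only [Fin.sum_univ_succ (n := d), Fin.cons_zero, Fin.cons_succ, Nat.cast_zero,
        ne_eq, OfNat.ofNat_ne_zero, not_false_eq_true, zero_pow, zero_add]
      simp only [e]
      rw [Finset.sum_add_distrib, Finset.sum_add_distrib, Finset.sum_add_distrib]
      rw [ihM, sum_N, sum_Z, ihd, cc_r1 d M, cc_r2 d M]
      push_cast
      have : (M:ℝ)+d+2 ≠ 0 := by positivity
      field_simp; ring

lemma moment_eq (d M k : ℕ) (h : ∀ l : Fin d → ℕ, Integrable (fun x : Fin d → ℝ =>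
      (∑ i, x i ^ 2)^k * ∏ j, ψho (l j) (x j) ^ 2)) :
    ∫ x : EuclideanSpace ℝ (Fin d), ‖x‖ ^ (2 * k) * fermiDensity d M x =
     ∑ l ∈ SS d M, ∫ x : Fin d → ℝ, (∑ i, x i ^ 2)^k * ∏ j, ψho (l j) (x j) ^ 2 := by
  rw [← (PiLp.volume_preserving_toLp (Fin d)).integral_comp
    (MeasurableEquiv.toLp 2 _).measurableEmbedding]
  rw [← integral_finsetSum _ fun l _ => h l]
  congr 1
  ext x
  rw [pow_mul, EuclideanSpace.norm_sq_eq, fermiDensity, Finset.mul_sum]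
  simp only [Real.norm_eq_abs, sq_abs]
  rfl

/-- with `M̃ = M + (d+1)/2`, the second and fourth normalised radial
moments are `m₂ = d M̃/(d+1)` and `m₄ = (d/(d+1))(M̃² + (d+1)/4)`. -/
theorem fermi_second_and_fourth_moments (d M : ℕ) (hd : 1 ≤ d)
    (m : ℕ → ℝ)
    (hm : ∀ k : ℕ, m k = (1 / (Nat.choose (M + d) d : ℝ)) *
        ∫ x : EuclideanSpace ℝ (Fin d), ‖x‖ ^ (2 * k) * fermiDensity d M x) :
    m 1 = (d : ℝ) * ((M : ℝ) + ((d : ℝ) + 1) / 2) / ((d : ℝ) + 1) ∧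
      m 2 = ((d : ℝ) / ((d : ℝ) + 1)) *
        (((M : ℝ) + ((d : ℝ) + 1) / 2) ^ 2 + ((d : ℝ) + 1) / 4) := by
  have hc : cc d M ≠ 0 := by
    unfold cc
    exact_mod_cast (Nat.choose_pos (Nat.le_add_left d M)).ne'
  have hcc : (Nat.choose (M + d) d : ℝ) = cc d M := rfl
  constructor
  · rw [hm, moment_eq d M 1 (by simpa using fun l => (int2 l).1), hcc]
    simp only [pow_one, (int2 _).2]
    rw [Finset.sum_add_distrib, sum_A]
    have : ∑ l ∈ SS d M, (d:ℝ)/2 = d/2 * cc d M := by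
      rw [← sum_N, Finset.mul_sum]; simp
    rw [this]
    field_simp
  · rw [hm, moment_eq d M 2 (fun l => (int4 l).1), hcc]
    simp only [(int4 _).2]
    have : ∑ l ∈ SS d M, ((∑ i, (l i:ℝ) + d / 2)^2 + ((∑ i, (l i:ℝ)^2)/2 + (∑ i, (l i:ℝ))/2 + d/2))
       = (∑ l ∈ SS d M, (∑ i, (l i:ℝ))^2) + (d + 1/2) * (∑ l ∈ SS d M, (∑ i, (l i:ℝ)))
        + 1/2 * (∑ l ∈ SS d M, (∑ i, (l i:ℝ)^2)) + (d^2/4 + d/2) * ∑ l ∈ SS d M, (1:ℝ) := by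
      rw [Finset.mul_sum (SS d M), Finset.mul_sum (SS d M), Finset.mul_sum (SS d M),
        ← Finset.sum_add_distrib, ← Finset.sum_add_distrib, ← Finset.sum_add_distrib]
      refine Finset.sum_congr rfl fun l _ => ?_
      ring
    rw [this, sum_A, sum_B, sum_Q, sum_N]
    field_simp; ring
end
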